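/- There exists a family of nonnegative real numbers {c(τ,τ') : τ' ≺ τ}, not depending on the seed, such that for every seed tree S, every decorated tree τ with w(τ) > 1, and every n ≥ |S|, almost surely E[D_τ(T_{n+1}^{(S)}) | F_n] = (1 + w(τ)/(2n−2)) · D_τ(T_n^{(S)}) + (2n−2)^{−1} · Σ_{τ' ≺ τ} c(τ,τ') · D_{τ'}(T_n^{(S)}). -/

import Mathlib

open Finset

noncomputable section

namespace LPAM

attribute [local instance] Classical.propDecidable

/-- The tree obtained from `G` by attaching a new vertex (the last element of `Fin (n+1)`)
to the vertex `v` of `G`. -/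
def attach {n : ℕ} (G : SimpleGraph (Fin n)) (v : Fin n) : SimpleGraph (Fin (n + 1)) :=
  SimpleGraph.fromRel fun a b =>
    (∃ a' b' : Fin n, a = a'.castSucc ∧ b = b'.castSucc ∧ G.Adj a' b') ∨
    (a = Fin.last n ∧ b = v.castSucc)

/-- The degree of a vertex. -/
def deg {n : ℕ} (G : SimpleGraph (Fin n)) (v : Fin n) : ℕ := (G.neighborSet v).ncard

/-- The law of the linear preferential attachment tree after `k` steps started from the
seed `S`: at each step, a new vertex is joined by an edge to a random vertex of the current
tree chosen with probability proportional to its degree. -/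
def law {n₀ : ℕ} (S : SimpleGraph (Fin n₀)) : (k : ℕ) → SimpleGraph (Fin (n₀ + k)) → ℝ
  | 0, G => if G = S then 1 else 0
  | (k + 1), G =>
      ∑ H : SimpleGraph (Fin (n₀ + k)), ∑ v : Fin (n₀ + k),
        law S k H * ((deg H v : ℝ) / (2 * (n₀ + k : ℕ) - 2)) *
          (if attach H v = G then 1 else 0)

/-- The law of the preferential attachment tree `T_n^{(S)}` with seed `S`, as a function on
graphs on `Fin n` (zero if `n < |S|`). -/
def lawAt {n₀ : ℕ} (S : SimpleGraph (Fin n₀)) (n : ℕ) (G : SimpleGraph (Fin n)) : ℝ :=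
  if h : n₀ ≤ n then
    law S (n - n₀) (cast (congrArg (fun m => SimpleGraph (Fin m)) (Nat.add_sub_cancel' h).symm) G)
  else 0

/-- A decorated tree: a finite tree together with a positive integer label on each vertex. -/
structure DecTree where
  n : ℕ
  graph : SimpleGraph (Fin n)
  isTree : graph.IsTree
  label : Fin n → ℕ
  label_pos : ∀ u, 0 < label u

/-- The weight of a decorated tree: the sum of its labels. -/
def DecTree.weight (τ : DecTree) : ℕ := ∑ u, τ.label u

/-- The strict partial order `≺` on decorated trees. -/
def DecTree.lt (τ' τ : DecTree) : Prop :=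
  (τ'.weight < τ.weight ∧ τ'.n ≤ τ.n) ∨ (τ'.weight = τ.weight ∧ τ'.n < τ.n)

/-- The partial order `⪯` associated with `≺`. -/
def DecTree.le (τ' τ : DecTree) : Prop := DecTree.lt τ' τ ∨ τ' = τ

/-- The observable `D_τ(T) = ∑_φ ∏_{u ∈ τ} [deg_T φ(u)]_{ℓ(u)}`, the sum running over all
embeddings (injective graph homomorphisms) `φ : τ → T`. -/
def Dval (τ : DecTree) {m : ℕ} (T : SimpleGraph (Fin m)) : ℝ :=
  ∑ φ : Fin τ.n → Fin m,
    if Function.Injective φ ∧ ∀ a b, τ.graph.Adj a b → T.Adj (φ a) (φ b) then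
      ∏ u, ((deg T (φ u)).descFactorial (τ.label u) : ℝ)
    else 0

/-- The expectation `E[D_τ(T_n^{(S)})]`. -/
def expD {n₀ : ℕ} (S : SimpleGraph (Fin n₀)) (τ : DecTree) (n : ℕ) : ℝ :=
  ∑ G : SimpleGraph (Fin n), lawAt S n G * Dval τ G

/-- `a ≪ b` : there are `c > 0` and `γ ∈ ℝ` with `|a_n| ≤ c (log n)^γ |b_n|` for `n` large. -/
def Lsim (a b : ℕ → ℝ) : Prop :=
  ∃ c γ : ℝ, 0 < c ∧ ∀ᶠ n : ℕ in Filter.atTop, |a n| ≤ c * Real.log n ^ γ * |b n|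

end LPAM

open MeasureTheory

namespace LPAM

attribute [local instance] Classical.propDecidable

instance graphMeasurableSpace (n : ℕ) : MeasurableSpace (SimpleGraph (Fin n)) := ⊤

/-- `T` is a linear preferential attachment chain with seed `S` on the filtered probability
space `(Ω, F, μ)`: it is adapted, starts at `S`, and conditionally on `F_n`, the tree at time
`n+1` is obtained from the tree at time `n` by attaching a new vertex to a vertex `v` chosen
with probability proportional to its degree, i.e. `deg v/(2n−2)`. -/
def IsLPAMChain {n₀ : ℕ} (S : SimpleGraph (Fin n₀)) {Ω : Type*} {mΩ : MeasurableSpace Ω}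
    (μ : Measure Ω) (F : Filtration ℕ mΩ) (T : (n : ℕ) → Ω → SimpleGraph (Fin n)) : Prop :=
  (∀ n, @Measurable _ _ (F n) _ (T n)) ∧
  (∀ᵐ ω ∂μ, T n₀ ω = S) ∧
  (∀ n, n₀ ≤ n → ∀ A : Set Ω, MeasurableSet[F n] A → ∀ G' : SimpleGraph (Fin (n + 1)),
    μ (A ∩ {ω | T (n + 1) ω = G'}) =
      ∑ H : SimpleGraph (Fin n), ∑ v : Fin n,
        (if attach H v = G' then ENNReal.ofReal ((deg H v : ℝ) / (2 * (n : ℝ) - 2)) else 0) *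
          μ (A ∩ {ω | T n ω = H}))

open scoped NNReal

section Attach

variable {m : ℕ} (G : SimpleGraph (Fin m)) (v : Fin m)

lemma attach_adj_castSucc (x y : Fin m) :
    (attach G v).Adj x.castSucc y.castSucc ↔ G.Adj x y := by
  have h : ∀ z : Fin m, ¬ z.castSucc = Fin.last m := fun z => (Fin.castSucc_lt_last z).ne
  simp only [attach, SimpleGraph.fromRel_adj, ne_eq, Fin.castSucc_inj, h, false_and, or_false]
  constructor
  · rintro ⟨-, ⟨a, b, rfl, rfl, hab⟩ | ⟨a, b, rfl, rfl, hab⟩⟩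
    · exact hab
    · exact hab.symm
  · exact fun hxy => ⟨hxy.ne, Or.inl ⟨x, y, rfl, rfl, hxy⟩⟩

lemma attach_adj_last_castSucc (x : Fin m) :
    (attach G v).Adj (Fin.last m) x.castSucc ↔ x = v := by
  have h : ∀ z : Fin m, ¬ z.castSucc = Fin.last m := fun z => (Fin.castSucc_lt_last z).ne
  have h' : ∀ z : Fin m, ¬ Fin.last m = z.castSucc := fun z => (Fin.castSucc_lt_last z).ne'
  simp [attach, SimpleGraph.fromRel_adj, h, h']

lemma attach_adj_castSucc_last (x : Fin m) :
    (attach G v).Adj x.castSucc (Fin.last m) ↔ x = v := by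
  rw [SimpleGraph.adj_comm, attach_adj_last_castSucc]

lemma deg_eq_sum (x : Fin m) : deg G x = ∑ y, if G.Adj x y then 1 else 0 := by
  rw [← Finset.card_filter, deg, Set.ncard_eq_toFinset_card']
  congr 1
  ext y
  simp

lemma deg_attach_castSucc (x : Fin m) :
    deg (attach G v) x.castSucc = deg G x + if x = v then 1 else 0 := by
  simp only [deg_eq_sum, Fin.sum_univ_castSucc, attach_adj_castSucc, attach_adj_castSucc_last]

lemma deg_attach_last : deg (attach G v) (Fin.last m) = 1 := by
  simp only [deg_eq_sum, Fin.sum_univ_castSucc, attach_adj_last_castSucc, SimpleGraph.irrefl]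
  simp

lemma sum_deg_attach : ∑ x, deg (attach G v) x = ∑ x, deg G x + 2 := by
  rw [Fin.sum_univ_castSucc, deg_attach_last]
  simp [deg_attach_castSucc, Finset.sum_add_distrib]

lemma sum_deg_of_isTree {G : SimpleGraph (Fin m)} (hG : G.IsTree) :
    ∑ x, deg G x + 2 = 2 * m := by
  have h1 : ∀ x, deg G x = G.degree x := fun x => by
    rw [deg, Set.ncard_eq_toFinset_card', ← SimpleGraph.card_neighborFinset_eq_degree]
    rfl
  simp only [h1]
  have h2 := hG.card_edgeFinset
  rw [G.sum_degrees_eq_twice_card_edges]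
  rw [Fintype.card_fin] at h2
  omega

end Attach

/-- `φ` is an injective homomorphism from `g` to `G`. -/
def IsEmb {k m : ℕ} (g : SimpleGraph (Fin k)) (G : SimpleGraph (Fin m))
    (φ : Fin k → Fin m) : Prop :=
  Function.Injective φ ∧ ∀ a b, g.Adj a b → G.Adj (φ a) (φ b)

/-- The contribution of a map `φ` to the observable of the decorated graph `(g, l)`. -/
def embTerm {k m : ℕ} (g : SimpleGraph (Fin k)) (l : Fin k → ℕ) (G : SimpleGraph (Fin m))
    (φ : Fin k → Fin m) : ℝ :=
  if IsEmb g G φ then ∏ u, ((deg G (φ u)).descFactorial (l u) : ℝ) else 0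

/-- The observable of a decorated graph `(g, l)`, not necessarily a tree. -/
def embSum {k m : ℕ} (g : SimpleGraph (Fin k)) (l : Fin k → ℕ) (G : SimpleGraph (Fin m)) : ℝ :=
  ∑ φ : Fin k → Fin m, embTerm g l G φ

lemma Dval_eq_embSum (τ : DecTree) {m : ℕ} (G : SimpleGraph (Fin m)) :
    Dval τ G = embSum τ.graph τ.label G := by
  unfold Dval embSum embTerm IsEmb
  congr!

/-- The cone of nonnegative combinations of the observables of decorated trees below `τ`. -/
def lowerCone (τ : DecTree) : Submodule ℝ≥0 ((Σ m, SimpleGraph (Fin m)) → ℝ) :=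
  Submodule.span ℝ≥0
    ((fun τ' (p : Σ m, SimpleGraph (Fin m)) => Dval τ' p.2) '' {τ' | DecTree.lt τ' τ})

lemma mul_embSum_mem_lowerCone {τ : DecTree} {k : ℕ} {g : SimpleGraph (Fin k)} {l : Fin k → ℕ}
    (hg : g.IsTree) (c : ℕ) (hl : c ≠ 0 → ∀ u, 0 < l u)
    (hlt : c ≠ 0 → ((∑ u, l u < τ.weight ∧ k ≤ τ.n) ∨ (∑ u, l u = τ.weight ∧ k < τ.n))) :
    (fun p : Σ m, SimpleGraph (Fin m) => (c : ℝ) * embSum g l p.2) ∈ lowerCone τ := by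
  by_cases hc : c = 0
  · subst hc
    simp only [Nat.cast_zero, zero_mul]
    exact (lowerCone τ).zero_mem
  · have h := (lowerCone τ).smul_mem (c : ℝ≥0)
      (Submodule.subset_span ⟨⟨k, g, hg, l, hl hc⟩, hlt hc, rfl⟩)
    convert h using 1
    ext p
    simp [Dval_eq_embSum, NNReal.smul_def]

lemma exists_finset_of_mem_lowerCone {τ : DecTree} {L : (Σ m, SimpleGraph (Fin m)) → ℝ}
    (hL : L ∈ lowerCone τ) :
    ∃ (ts : Finset DecTree) (c : DecTree → ℝ), (∀ τ' ∈ ts, DecTree.lt τ' τ ∧ 0 ≤ c τ') ∧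
      ∀ (m : ℕ) (G : SimpleGraph (Fin m)), L ⟨m, G⟩ = ∑ τ' ∈ ts, c τ' * Dval τ' G := by
  obtain ⟨f, hf, rfl⟩ := (Finsupp.mem_span_image_iff_linearCombination ℝ≥0).1 hL
  refine ⟨f.support, fun τ' => f τ', fun τ' h => ⟨hf h, (f τ').2⟩, fun m G => ?_⟩
  rw [Finsupp.linearCombination_apply, Finsupp.sum, Finset.sum_apply]
  rfl

/-- At most one factor of the product is modified, the one whose index is sent to `v`. -/
lemma prod_ite_eq_add_sum {k m : ℕ} {ψ : Fin k → Fin m} (hψ : Function.Injective ψ)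
    (v : Fin m) (p q : Fin k → ℝ) :
    ∏ u, (if ψ u = v then q u else p u) = ∏ u, p u +
      ∑ i, if ψ i = v then (q i - p i) * ∏ u ∈ univ.erase i, p u else 0 := by
  by_cases h : ∃ i, ψ i = v
  · obtain ⟨i, rfl⟩ := h
    simp only [hψ.eq_iff, Finset.sum_ite_eq', Finset.mem_univ, if_true]
    rw [← Finset.mul_prod_erase _ _ (Finset.mem_univ i),
      ← Finset.mul_prod_erase univ p (Finset.mem_univ i), if_pos rfl,
      Finset.prod_congr rfl fun u hu => if_neg (Finset.ne_of_mem_erase hu)]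
    ring
  · push Not at h
    simp [h]

lemma prod_erase_update {k : ℕ} (d l : Fin k → ℕ) (i : Fin k) (j : ℕ) :
    ∏ u, ((d u).descFactorial (Function.update l i j u) : ℝ) =
      (d i).descFactorial j * ∏ u ∈ univ.erase i, ((d u).descFactorial (l u) : ℝ) := by
  rw [← Finset.mul_prod_erase _ _ (Finset.mem_univ i), Function.update_self]
  congr 1
  exact Finset.prod_congr rfl fun u hu => by
    rw [Function.update_of_ne (Finset.ne_of_mem_erase hu)]

lemma cast_mul_descFactorial (d l : ℕ) :
    (d : ℝ) * d.descFactorial l = d.descFactorial (l + 1) + l * d.descFactorial l := by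
  rw [Nat.descFactorial_succ]
  rcases le_or_gt l d with h | h
  · push_cast [Nat.cast_sub h]
    ring
  · simp [Nat.descFactorial_of_lt h]

lemma cast_succ_descFactorial (d l : ℕ) :
    ((d + 1).descFactorial l : ℝ) = d.descFactorial l + l * d.descFactorial (l - 1) := by
  cases l with
  | zero => simp
  | succ l =>
    have h := cast_mul_descFactorial d l
    rw [Nat.succ_descFactorial_succ]
    push_cast
    linarith

/-- The change of a falling factorial under a unit increase, biased by the degree. -/
lemma cast_mul_succ_descFactorial_sub (d l : ℕ) :
    (d : ℝ) * ((d + 1).descFactorial l - d.descFactorial l) =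
      l * d.descFactorial l + (l * (l - 1) : ℕ) * d.descFactorial (l - 1) := by
  rw [cast_succ_descFactorial]
  cases l with
  | zero => simp
  | succ l =>
    have h := cast_mul_descFactorial d l
    simp only [Nat.add_sub_cancel]
    push_cast
    linear_combination ((l : ℝ) + 1) * h

section Recurrence

variable {k m : ℕ}

lemma isEmb_attach_castSucc (g : SimpleGraph (Fin k)) (G : SimpleGraph (Fin m)) (v : Fin m)
    (ψ : Fin k → Fin m) : IsEmb g (attach G v) (fun u => (ψ u).castSucc) ↔ IsEmb g G ψ := by
  simp only [IsEmb, attach_adj_castSucc]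
  exact and_congr_left fun _ => (Fin.castSucc_injective m).of_comp_iff ψ

lemma descFactorial_deg_attach (G : SimpleGraph (Fin m)) (v x : Fin m) (j : ℕ) :
    ((deg (attach G v) x.castSucc).descFactorial j : ℝ) =
      if x = v then ((deg G x + 1).descFactorial j : ℝ) else (deg G x).descFactorial j := by
  rw [deg_attach_castSucc]
  split_ifs <;> rfl

/-- The part of the observable of `attach G v` coming from maps that send `a` to the new
vertex. -/
def newVertexSum (g : SimpleGraph (Fin k)) (l : Fin k → ℕ) (G : SimpleGraph (Fin m)) (v : Fin m)
    (a : Fin k) : ℝ :=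
  ∑ φ : Fin k → Fin (m + 1), if φ a = Fin.last m then embTerm g l (attach G v) φ else 0

lemma embSum_attach (g : SimpleGraph (Fin k)) (l : Fin k → ℕ) (G : SimpleGraph (Fin m))
    (v : Fin m) :
    embSum g l (attach G v) =
      ∑ ψ : Fin k → Fin m, embTerm g l (attach G v) (fun u => (ψ u).castSucc) +
        ∑ a, newVertexSum g l G v a := by
  have h1 : ∑ ψ : Fin k → Fin m, embTerm g l (attach G v) (fun u => (ψ u).castSucc) =
      ∑ φ : Fin k → Fin (m + 1),
        if ∀ u, φ u ≠ Fin.last m then embTerm g l (attach G v) φ else 0 := by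
    refine Finset.sum_of_injOn (fun ψ u => (ψ u).castSucc) ?_ ?_ ?_ ?_
    · exact fun ψ _ ψ' _ h => funext fun u => Fin.castSucc_injective m (congrFun h u)
    · exact fun ψ _ => Finset.mem_coe.2 (Finset.mem_univ _)
    · refine fun φ _ hφ => if_neg fun h => hφ ?_
      exact ⟨fun u => (φ u).castPred (h u), by simp, by simp⟩
    · exact fun ψ _ => (if_pos fun u => (Fin.castSucc_lt_last (ψ u)).ne).symm
  rw [h1]
  simp only [newVertexSum]
  rw [Finset.sum_comm, ← Finset.sum_add_distrib]
  refine Finset.sum_congr rfl fun φ _ => ?_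
  by_cases h : ∃ a, φ a = Fin.last m
  · obtain ⟨a, ha⟩ := h
    rw [if_neg (fun h => h a ha), zero_add]
    by_cases hφ : IsEmb g (attach G v) φ
    · simp only [← ha, hφ.1.eq_iff, Finset.sum_ite_eq', Finset.mem_univ, if_true]
    · simp [embTerm, hφ]
  · push Not at h
    simp [h]

lemma sum_deg_mul_sum_embTerm_castSucc (g : SimpleGraph (Fin k)) (l : Fin k → ℕ)
    (G : SimpleGraph (Fin m)) :
    ∑ v, (deg G v : ℝ) *
        ∑ ψ : Fin k → Fin m, embTerm g l (attach G v) (fun u => (ψ u).castSucc) =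
      (∑ v, (deg G v : ℝ) + ∑ u, (l u : ℝ)) * embSum g l G +
        ∑ i, ((l i * (l i - 1) : ℕ) : ℝ) * embSum g (Function.update l i (l i - 1)) G := by
  simp only [embSum, Finset.mul_sum]
  rw [Finset.sum_comm, Finset.sum_comm (s := univ (α := Fin k)), ← Finset.sum_add_distrib]
  refine Finset.sum_congr rfl fun ψ _ => ?_
  by_cases hψ : IsEmb g G ψ
  · simp only [embTerm, isEmb_attach_castSucc, hψ, if_true, descFactorial_deg_attach,
      prod_erase_update]
    simp_rw [fun v => prod_ite_eq_add_sum hψ.1 v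
      (fun u => ((deg G (ψ u)).descFactorial (l u) : ℝ))
      (fun u => ((deg G (ψ u) + 1).descFactorial (l u) : ℝ)), mul_add,
      Finset.sum_add_distrib, Finset.mul_sum]
    rw [Finset.sum_comm, add_mul, Finset.sum_mul, add_assoc, Finset.sum_mul,
      ← Finset.sum_add_distrib]
    congr 1
    refine Finset.sum_congr rfl fun i _ => ?_
    simp only [mul_ite, mul_zero, Finset.sum_ite_eq, Finset.mem_univ, if_true]
    rw [← Finset.mul_prod_erase univ (fun u => ((deg G (ψ u)).descFactorial (l u) : ℝ))
      (Finset.mem_univ i)]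
    linear_combination (∏ u ∈ univ.erase i, ((deg G (ψ u)).descFactorial (l u) : ℝ)) *
      cast_mul_succ_descFactorial_sub (deg G (ψ i)) (l i)
  · simp [embTerm, isEmb_attach_castSucc, hψ]

lemma newVertexSum_eq_zero_of_label_ne_one {g : SimpleGraph (Fin k)} {l : Fin k → ℕ} {a : Fin k}
    (ha : 1 < l a) (G : SimpleGraph (Fin m)) (v : Fin m) : newVertexSum g l G v a = 0 := by
  refine Finset.sum_eq_zero fun φ _ => ?_
  split_ifs with h
  · unfold embTerm
    split_ifs
    · refine Finset.prod_eq_zero (Finset.mem_univ a) ?_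
      rw [h, deg_attach_last, Nat.descFactorial_of_lt ha, Nat.cast_zero]
    · rfl
  · rfl

lemma newVertexSum_eq_zero_of_adj_of_adj {g : SimpleGraph (Fin k)} {l : Fin k → ℕ} {a b c : Fin k}
    (hb : g.Adj a b) (hc : g.Adj a c) (hbc : b ≠ c) (G : SimpleGraph (Fin m)) (v : Fin m) :
    newVertexSum g l G v a = 0 := by
  refine Finset.sum_eq_zero fun φ _ => ?_
  split_ifs with h
  · refine if_neg fun hφ => hbc (hφ.1 ?_)
    have key : ∀ x, g.Adj a x → φ x = v.castSucc := fun x hx => by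
      have h2 := hφ.2 a x hx
      rw [h] at h2
      obtain ⟨y, hy⟩ := Fin.exists_castSucc_eq.2 h2.ne'
      rw [← hy] at h2 ⊢
      rw [(attach_adj_last_castSucc G v y).1 h2]
    rw [key b hb, key c hc]
  · rfl

lemma newVertexSum_eq_sum_insertNth (g : SimpleGraph (Fin (k + 1))) (l : Fin (k + 1) → ℕ)
    (G : SimpleGraph (Fin m)) (v : Fin m) (a : Fin (k + 1)) :
    newVertexSum g l G v a = ∑ ψ : Fin k → Fin m, embTerm g l (attach G v)
      (a.insertNth (Fin.last m) (fun u => (ψ u).castSucc) : Fin (k + 1) → Fin (m + 1)) := by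
  refine (Finset.sum_of_injOn (fun ψ : Fin k → Fin m =>
    (a.insertNth (Fin.last m) (fun u => (ψ u).castSucc) : Fin (k + 1) → Fin (m + 1)))
    ?_ ?_ ?_ ?_).symm
  · refine fun ψ _ ψ' _ h => funext fun u => Fin.castSucc_injective m ?_
    simpa using congrFun h (a.succAbove u)
  · exact fun ψ _ => Finset.mem_coe.2 (Finset.mem_univ _)
  · intro φ _ hφ
    split_ifs with h
    · refine if_neg fun hemb => hφ ?_
      have hne : ∀ u, φ (a.succAbove u) ≠ Fin.last m := fun u hu =>
        Fin.succAbove_ne a u (hemb.1 (hu.trans h.symm))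
      refine ⟨fun u => (φ (a.succAbove u)).castPred (hne u), by simp, ?_⟩
      simp only [Fin.castSucc_castPred]
      rw [← h]
      exact Fin.insertNth_self_removeNth a φ
    · rfl
  · exact fun ψ _ => (if_pos (by simp)).symm

lemma isEmb_attach_insertNth {g : SimpleGraph (Fin (k + 1))} {a : Fin (k + 1)} {b : Fin k}
    (hb : ∀ x, g.Adj a x ↔ x = a.succAbove b) (G : SimpleGraph (Fin m)) (v : Fin m)
    (ψ : Fin k → Fin m) :
    IsEmb g (attach G v)
        (a.insertNth (Fin.last m) (fun u => (ψ u).castSucc) : Fin (k + 1) → Fin (m + 1)) ↔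
      IsEmb (g.comap a.succAbove) G ψ ∧ ψ b = v := by
  have hadj : ∀ u, g.Adj a (a.succAbove u) ↔ u = b := fun u => by
    rw [hb, Fin.succAbove_right_inj]
  have hadj' : ∀ u, g.Adj (a.succAbove u) a ↔ u = b := fun u => by
    rw [SimpleGraph.adj_comm, hadj]
  have hinj : Function.Injective
      (a.insertNth (Fin.last m) (fun u => (ψ u).castSucc) : Fin (k + 1) → Fin (m + 1)) ↔
      Function.Injective ψ := by
    simp only [Function.Injective, Fin.forall_iff_succAbove a, Fin.insertNth_apply_same,
      Fin.insertNth_apply_succAbove, Fin.castSucc_inj, Fin.succAbove_right_inj,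
      (Fin.castSucc_lt_last _).ne, (Fin.castSucc_lt_last _).ne', false_imp_iff, true_and,
      implies_true]
  simp only [IsEmb, hinj, Fin.forall_iff_succAbove a, Fin.insertNth_apply_same,
    Fin.insertNth_apply_succAbove, attach_adj_castSucc, attach_adj_last_castSucc,
    attach_adj_castSucc_last, hadj, hadj', SimpleGraph.comap_adj, SimpleGraph.irrefl,
    forall_eq, false_imp_iff, true_and]
  aesop

lemma sum_deg_mul_newVertexSum {g : SimpleGraph (Fin (k + 1))} {l : Fin (k + 1) → ℕ}
    {a : Fin (k + 1)} {b : Fin k} (hb : ∀ x, g.Adj a x ↔ x = a.succAbove b) (ha : l a = 1)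
    (G : SimpleGraph (Fin m)) :
    ∑ v, (deg G v : ℝ) * newVertexSum g l G v a =
      ((1 : ℕ) : ℝ) * embSum (g.comap a.succAbove)
          (Function.update (l ∘ a.succAbove) b (l (a.succAbove b) + 1)) G +
        ((2 * l (a.succAbove b) : ℕ) : ℝ) * embSum (g.comap a.succAbove) (l ∘ a.succAbove) G +
        ((l (a.succAbove b) * (l (a.succAbove b) - 1) : ℕ) : ℝ) * embSum (g.comap a.succAbove)
          (Function.update (l ∘ a.succAbove) b (l (a.succAbove b) - 1)) G := by
  simp only [newVertexSum_eq_sum_insertNth, embSum, Finset.mul_sum]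
  rw [Finset.sum_comm, ← Finset.sum_add_distrib, ← Finset.sum_add_distrib]
  refine Finset.sum_congr rfl fun ψ _ => ?_
  by_cases hψ : IsEmb (g.comap a.succAbove) G ψ
  · have hprod : ∀ v, ∏ u, ((deg (attach G v) ((a.insertNth (Fin.last m)
        (fun u => (ψ u).castSucc) : Fin (k + 1) → Fin (m + 1)) u)).descFactorial (l u) : ℝ) =
        ∏ u, if ψ u = v then ((deg G (ψ u) + 1).descFactorial (l (a.succAbove u)) : ℝ)
          else (deg G (ψ u)).descFactorial (l (a.succAbove u)) := fun v => by
      rw [Fin.prod_univ_succAbove _ a]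
      simp [deg_attach_last, ha, descFactorial_deg_attach]
    simp only [embTerm, isEmb_attach_insertNth hb, hψ, true_and, if_true, hprod, mul_ite,
      mul_zero, Finset.sum_ite_eq, Finset.mem_univ, prod_erase_update, Function.comp_apply]
    rw [← Finset.mul_prod_erase _ _ (Finset.mem_univ b), if_pos rfl,
      Finset.prod_congr rfl fun u hu => if_neg fun h => Finset.ne_of_mem_erase hu (hψ.1 h),
      ← Finset.mul_prod_erase univ
        (fun u => ((deg G (ψ u)).descFactorial (l (a.succAbove u)) : ℝ)) (Finset.mem_univ b)]
    have h1 := cast_mul_succ_descFactorial_sub (deg G (ψ b)) (l (a.succAbove b))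
    have h2 := cast_mul_descFactorial (deg G (ψ b)) (l (a.succAbove b))
    push_cast at h1 ⊢
    linear_combination
      (∏ u ∈ univ.erase b, ((deg G (ψ u)).descFactorial (l (a.succAbove u)) : ℝ)) * (h1 + h2)
  · simp [embTerm, isEmb_attach_insertNth hb, hψ]

lemma isTree_comap_succAbove {g : SimpleGraph (Fin (k + 1))} (hg : g.IsTree) {a : Fin (k + 1)}
    {b : Fin k} (hb : ∀ x, g.Adj a x ↔ x = a.succAbove b) : (g.comap a.succAbove).IsTree := by
  refine ⟨?_, hg.isAcyclic.comap ⟨a.succAbove, fun h => h⟩ Fin.succAbove_right_injective⟩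
  have hdeg : g.degree a = 1 :=
    SimpleGraph.degree_eq_one_iff_existsUnique_adj.2
      ⟨a.succAbove b, (hb _).2 rfl, fun x hx => (hb x).1 hx⟩
  let e : g.comap a.succAbove ≃g g.induce {a}ᶜ :=
    ⟨finSuccAboveEquiv a, Iff.rfl⟩
  exact e.connected_iff.2 (hg.connected.induce_compl_singleton_of_degree_eq_one hdeg)

lemma sum_update_add (f : Fin k → ℕ) (i : Fin k) (x : ℕ) :
    ∑ u, Function.update f i x u + f i = ∑ u, f u + x := by
  rw [← Finset.add_sum_erase _ _ (Finset.mem_univ i),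
    ← Finset.add_sum_erase univ f (Finset.mem_univ i), Function.update_self,
    Finset.sum_congr rfl fun u hu => Function.update_of_ne (Finset.ne_of_mem_erase hu) x f]
  ring

lemma update_pos {f : Fin k → ℕ} (hf : ∀ u, 0 < f u) (i : Fin k) {x : ℕ} (hx : 0 < x)
    (u : Fin k) : 0 < Function.update f i x u := by
  rcases eq_or_ne u i with rfl | h
  · rwa [Function.update_self]
  · rw [Function.update_of_ne h]
    exact hf u

lemma sum_deg_mul_newVertexSum_mem_lowerCone {τ : DecTree} (hw : 1 < τ.weight) (a : Fin τ.n) :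
    (fun p : Σ m, SimpleGraph (Fin m) =>
      ∑ v, (deg p.2 v : ℝ) * newVertexSum τ.graph τ.label p.2 v a) ∈ lowerCone τ := by
  obtain ⟨n, g, hg, l, hl⟩ := τ
  rcases n with _ | k
  · exact a.elim0
  simp only at a ⊢
  simp only [DecTree.weight] at hw
  by_cases ha : 1 < l a
  · simp only [newVertexSum_eq_zero_of_label_ne_one ha, mul_zero, Finset.sum_const_zero]
    exact Submodule.zero_mem _
  have ha : l a = 1 := le_antisymm (not_lt.1 ha) (hl a)
  rw [Fin.sum_univ_succAbove _ a, ha] at hw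
  have : Nontrivial (Fin (k + 1)) := by
    rcases k with _ | k
    · simp at hw
    · infer_instance
  obtain ⟨c, hc⟩ := hg.connected.preconnected.exists_adj_of_nontrivial a
  by_cases huniq : ∃ d, g.Adj a d ∧ c ≠ d
  · obtain ⟨d, hd, hcd⟩ := huniq
    simp only [newVertexSum_eq_zero_of_adj_of_adj hc hd hcd, mul_zero, Finset.sum_const_zero]
    exact Submodule.zero_mem _
  push Not at huniq
  obtain ⟨b, rfl⟩ := Fin.exists_succAbove_eq hc.ne'
  have hb : ∀ x, g.Adj a x ↔ x = a.succAbove b :=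
    fun x => ⟨fun h => (huniq x h).symm, fun h => h ▸ hc⟩
  simp only [sum_deg_mul_newVertexSum hb ha]
  have htree := isTree_comap_succAbove hg hb
  have hsum := Fin.sum_univ_succAbove l a
  have hup := sum_update_add (l ∘ a.succAbove) b
  have hlb : ∀ u, 0 < (l ∘ a.succAbove) u := fun u => hl _
  have hlb' := hlb b
  simp only [Function.comp_apply] at hup hlb'
  refine Submodule.add_mem _ (Submodule.add_mem _
    (mul_embSum_mem_lowerCone htree 1 (fun _ => update_pos hlb b (Nat.succ_pos _)) fun _ => ?_)
    (mul_embSum_mem_lowerCone htree _ (fun _ => hlb) fun _ => ?_))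
    (mul_embSum_mem_lowerCone htree _ (fun h => update_pos hlb b ?_) fun h => ?_)
  · have := hup (l (a.succAbove b) + 1)
    simp only [DecTree.weight]
    omega
  · simp only [DecTree.weight, Function.comp_apply]
    omega
  · exact Nat.pos_of_ne_zero (right_ne_zero_of_mul h)
  · have := hup (l (a.succAbove b) - 1)
    simp only [DecTree.weight]
    omega

/-- The deterministic form of the recurrence, before normalising the attachment weights. -/
lemma exists_sum_deg_mul_Dval_attach {τ : DecTree} (hw : 1 < τ.weight) :
    ∃ L ∈ lowerCone τ, ∀ (m : ℕ) (G : SimpleGraph (Fin m)),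
      ∑ v, (deg G v : ℝ) * Dval τ (attach G v) =
        (∑ v, (deg G v : ℝ) + τ.weight) * Dval τ G + L ⟨m, G⟩ := by
  refine ⟨_, Submodule.add_mem _
    (Submodule.sum_mem _ (t := univ) (f := fun i (p : Σ m, SimpleGraph (Fin m)) =>
      ((τ.label i * (τ.label i - 1) : ℕ) : ℝ) *
        embSum τ.graph (Function.update τ.label i (τ.label i - 1)) p.2) fun i _ =>
      mul_embSum_mem_lowerCone τ.isTree _ (fun h => update_pos τ.label_pos i
        (Nat.pos_of_ne_zero (right_ne_zero_of_mul h))) fun h => ?_)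
    (Submodule.sum_mem _ (t := univ) fun a _ => sum_deg_mul_newVertexSum_mem_lowerCone hw a),
    fun m G => ?_⟩
  · have h1 := sum_update_add τ.label i (τ.label i - 1)
    have h2 := τ.label_pos i
    refine Or.inl ⟨?_, le_rfl⟩
    simp only [DecTree.weight]
    omega
  · have h := sum_deg_mul_sum_embTerm_castSucc τ.graph τ.label G
    simp only [Dval_eq_embSum, embSum_attach, mul_add, Finset.sum_add_distrib]
    rw [h, Pi.add_apply, Finset.sum_apply, Finset.sum_apply, DecTree.weight, Nat.cast_sum,
      add_assoc]
    congr 2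
    rw [Finset.sum_comm]
    simp only [Finset.mul_sum]

end Recurrence

section Chain

variable {n₀ : ℕ} {S : SimpleGraph (Fin n₀)} {Ω : Type*} {mΩ : MeasurableSpace Ω}
  {μ : Measure Ω} {F : Filtration ℕ mΩ} {T : (n : ℕ) → Ω → SimpleGraph (Fin n)}

instance graphMeasurableSingletonClass (n : ℕ) :
    MeasurableSingletonClass (SimpleGraph (Fin n)) := ⟨fun _ => trivial⟩

lemma setIntegral_comp_graph [IsFiniteMeasure μ] {n : ℕ} {X : Ω → SimpleGraph (Fin n)}
    (hX : Measurable X) (f : SimpleGraph (Fin n) → ℝ) (A : Set Ω) :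
    ∫ ω in A, f (X ω) ∂μ = ∑ G, μ.real (A ∩ {ω | X ω = G}) * f G := by
  have hf : AEStronglyMeasurable f ((μ.restrict A).map X) :=
    (measurable_of_finite f).aestronglyMeasurable
  rw [← integral_map hX.aemeasurable hf, integral_fintype .of_finite]
  refine Finset.sum_congr rfl fun G _ => ?_
  rw [map_measureReal_apply hX (measurableSet_singleton G),
    measureReal_restrict_apply (hX (measurableSet_singleton G)), Set.inter_comm, smul_eq_mul]
  rfl

lemma integrable_comp_graph [IsFiniteMeasure μ] {n : ℕ} {X : Ω → SimpleGraph (Fin n)}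
    (hX : Measurable X) (f : SimpleGraph (Fin n) → ℝ) : Integrable (fun ω => f (X ω)) μ :=
  (Integrable.of_finite (f := f) (μ := μ.map X)).comp_measurable hX

lemma IsLPAMChain.sum_deg (h : IsLPAMChain S μ F T) (hS : S.IsTree) {n : ℕ} (hn : n₀ ≤ n) :
    ∀ G : SimpleGraph (Fin n), μ {ω | T n ω = G} ≠ 0 → ∑ x, deg G x + 2 = 2 * n := by
  induction n, hn using Nat.le_induction with
  | base =>
    intro G hG
    have hGS : G = S := by
      by_contra hne
      refine hG (measure_mono_null (fun ω hω => ?_) h.2.1)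
      exact fun hω' => hne (hω.symm.trans hω')
    rw [hGS]
    exact sum_deg_of_isTree hS
  | succ n hn ih =>
    intro G' hG'
    have hstep := h.2.2 n hn Set.univ MeasurableSet.univ G'
    simp only [Set.univ_inter] at hstep
    rw [hstep] at hG'
    obtain ⟨H, -, hH⟩ := Finset.exists_ne_zero_of_sum_ne_zero hG'
    obtain ⟨v, -, hv⟩ := Finset.exists_ne_zero_of_sum_ne_zero hH
    have h1 := ih H (right_ne_zero_of_mul hv)
    have h2 : attach H v = G' := by
      by_contra hne
      simp [hne] at hv
    rw [← h2, sum_deg_attach]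
    omega

lemma IsLPAMChain.measureReal_inter [IsFiniteMeasure μ] (h : IsLPAMChain S μ F T) (hn₀ : 2 ≤ n₀)
    {n : ℕ} (hn : n₀ ≤ n) {A : Set Ω} (hA : MeasurableSet[F n] A) (G' : SimpleGraph (Fin (n + 1))) :
    μ.real (A ∩ {ω | T (n + 1) ω = G'}) =
      ∑ H : SimpleGraph (Fin n), ∑ v : Fin n,
        (if attach H v = G' then (deg H v : ℝ) / (2 * (n : ℝ) - 2) else 0) *
          μ.real (A ∩ {ω | T n ω = H}) := by
  have hpos : (0 : ℝ) ≤ 2 * (n : ℝ) - 2 := by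
    have : (2 : ℝ) ≤ n := by exact_mod_cast hn₀.trans hn
    linarith
  have hfin : ∀ (H : SimpleGraph (Fin n)) (v : Fin n),
      (if attach H v = G' then ENNReal.ofReal ((deg H v : ℝ) / (2 * (n : ℝ) - 2)) else 0) *
        μ (A ∩ {ω | T n ω = H}) ≠ ⊤ := fun H v =>
    ENNReal.mul_ne_top (by split_ifs <;> simp) (measure_ne_top _ _)
  rw [measureReal_def, h.2.2 n hn A hA G', ENNReal.toReal_sum fun H _ =>
    ENNReal.sum_ne_top.2 fun v _ => hfin H v]
  refine Finset.sum_congr rfl fun H _ => ?_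
  rw [ENNReal.toReal_sum fun v _ => hfin H v]
  refine Finset.sum_congr rfl fun v _ => ?_
  rw [ENNReal.toReal_mul, measureReal_def]
  split_ifs
  · rw [ENNReal.toReal_ofReal (by positivity)]
  · simp

/-- The conditional expectation of a function of the next tree is the average of this function
over the attachment point. -/
lemma IsLPAMChain.condExp_comp [IsFiniteMeasure μ] (h : IsLPAMChain S μ F T) (hn₀ : 2 ≤ n₀)
    {n : ℕ} (hn : n₀ ≤ n) (f : SimpleGraph (Fin (n + 1)) → ℝ) :
    μ[(fun ω => f (T (n + 1) ω)) | F n] =ᵐ[μ]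
      fun ω => ∑ v, (deg (T n ω) v : ℝ) / (2 * (n : ℝ) - 2) * f (attach (T n ω) v) := by
  have hT : ∀ j, Measurable (T j) := fun j => (h.1 j).mono (F.le j) le_rfl
  let g : SimpleGraph (Fin n) → ℝ :=
    fun H => ∑ v, (deg H v : ℝ) / (2 * (n : ℝ) - 2) * f (attach H v)
  refine (ae_eq_condExp_of_forall_setIntegral_eq (F.le n) (integrable_comp_graph (hT _) f)
    (g := fun ω => g (T n ω)) (fun A _ _ => (integrable_comp_graph (hT n) g).integrableOn)
    (fun A hA _ => ?_) ?_).symm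
  · rw [setIntegral_comp_graph (hT n) g A,
      setIntegral_comp_graph (hT (n + 1)) f A]
    simp only [h.measureReal_inter hn₀ hn hA, Finset.sum_mul]
    rw [Finset.sum_comm]
    refine Finset.sum_congr rfl fun H _ => ?_
    rw [Finset.sum_comm, Finset.mul_sum]
    refine Finset.sum_congr rfl fun v _ => ?_
    simp only [ite_mul, zero_mul, Finset.sum_ite_eq, Finset.mem_univ, if_true]
    ring
  · exact ((measurable_of_finite g).comp (h.1 n)).stronglyMeasurable.aestronglyMeasurable

end Chain

/-- **Lemma 6 (recurrence relation).** There exists a family of nonnegative real numbers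
`{c(τ,τ') : τ' ≺ τ}`, not depending on the seed, such that for every seed tree `S`, every
decorated tree `τ` with `w(τ) > 1` and every `n ≥ |S|`, almost surely
`E[D_τ(T_{n+1}^{(S)}) | F_n] = (1 + w(τ)/(2n−2)) D_τ(T_n^{(S)})
  + (2n−2)⁻¹ ∑_{τ' ≺ τ} c(τ,τ') D_{τ'}(T_n^{(S)})`. -/
theorem conditional_recurrence (τ : DecTree) (hw : 1 < τ.weight) :
    ∃ (ts : Finset DecTree) (c : DecTree → ℝ),
      (∀ τ' ∈ ts, DecTree.lt τ' τ ∧ 0 ≤ c τ') ∧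
      ∀ {n₀ : ℕ} (S : SimpleGraph (Fin n₀)), S.IsTree → 2 ≤ n₀ →
      ∀ {Ω : Type} {mΩ : MeasurableSpace Ω} (μ : Measure Ω), IsProbabilityMeasure μ →
      ∀ (F : Filtration ℕ mΩ) (T : (n : ℕ) → Ω → SimpleGraph (Fin n)),
        IsLPAMChain S μ F T →
        ∀ n, n₀ ≤ n →
          μ[(fun ω => Dval τ (T (n + 1) ω)) | F n] =ᵐ[μ]
            fun ω => (1 + (τ.weight : ℝ) / (2 * (n : ℝ) - 2)) * Dval τ (T n ω) +
              (2 * (n : ℝ) - 2)⁻¹ * ∑ τ' ∈ ts, c τ' * Dval τ' (T n ω) := by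
  obtain ⟨L, hL, hrec⟩ := exists_sum_deg_mul_Dval_attach hw
  obtain ⟨ts, c, hts, hsum⟩ := exists_finset_of_mem_lowerCone hL
  refine ⟨ts, c, hts, ?_⟩
  intro n₀ S hS hn₀ Ω mΩ μ hμ F T hT n hn
  have hae : ∀ᵐ ω ∂μ, ∑ x, deg (T n ω) x + 2 = 2 * n := by
    have hall : ∀ᵐ ω ∂μ, ∀ G : SimpleGraph (Fin n), μ {ω | T n ω = G} = 0 → T n ω ≠ G :=
      ae_all_iff.2 fun G => by
        by_cases h : μ {ω | T n ω = G} = 0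
        · filter_upwards [measure_eq_zero_iff_ae_notMem.1 h] with ω hω _ using hω
        · exact Filter.Eventually.of_forall fun ω h' => absurd h' h
    filter_upwards [hall] with ω hω
    exact hT.sum_deg hS hn _ fun h => hω _ h rfl
  filter_upwards [hT.condExp_comp hn₀ hn (fun G => Dval τ G), hae] with ω hω hdeg
  have hdeg' : ∑ x, (deg (T n ω) x : ℝ) = 2 * n - 2 := by
    rw [eq_sub_iff_add_eq]
    exact_mod_cast hdeg
  have hpos : (2 * (n : ℝ) - 2) ≠ 0 := by
    have : (2 : ℝ) ≤ n := by exact_mod_cast hn₀.trans hn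
    linarith
  have hr := hrec n (T n ω)
  rw [hdeg', hsum] at hr
  rw [hω]
  simp only [div_mul_eq_mul_div]
  rw [← Finset.sum_div, hr]
  generalize 2 * (n : ℝ) - 2 = d at hpos
  field_simp

end LPAM
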